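/- Let f(x,y,z) = x²y²+y²z²+z²x² − (x²+y²+z²) + 1 and Q = {p ∈ ℝ³ : f(p) = 0}. Then the set of singular points of Q, that is, the set of points p with f(p) = 0 at which all three partial derivatives of f vanish, is exactly the set of twelve points obtained from (1,1,0) by permuting the coordinates and changing signs of coordinates, i.e., the points (±1,±1,0), (±1,0,±1), (0,±1,±1). -/

import Mathlib

/-- The quartic polynomial `v - u + 1` defining `Q_{(1,0,-1)}(1)`. -/
noncomputable def fQ5 (p : EuclideanSpace ℝ (Fin 3)) : ℝ :=
  (p 0)^2*(p 1)^2 + (p 1)^2*(p 2)^2 + (p 2)^2*(p 0)^2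
    - ((p 0)^2 + (p 1)^2 + (p 2)^2) + 1

theorem hasFDerivAt_fQ5 (p : EuclideanSpace ℝ (Fin 3)) :
    HasFDerivAt fQ5
      ((2 * p 0 * ((p 1)^2 + (p 2)^2 - 1)) • EuclideanSpace.proj (𝕜 := ℝ) (0 : Fin 3)
        + (2 * p 1 * ((p 2)^2 + (p 0)^2 - 1)) • EuclideanSpace.proj (𝕜 := ℝ) (1 : Fin 3)
        + (2 * p 2 * ((p 0)^2 + (p 1)^2 - 1)) • EuclideanSpace.proj (𝕜 := ℝ) (2 : Fin 3) :
        EuclideanSpace ℝ (Fin 3) →L[ℝ] ℝ) p := by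
  have coord (i : Fin 3) : HasFDerivAt (fun q : EuclideanSpace ℝ (Fin 3) => (q i)^2)
      ((2 * p i) • (EuclideanSpace.proj i : EuclideanSpace ℝ (Fin 3) →L[ℝ] ℝ)) p := by
    simpa using (EuclideanSpace.proj (𝕜 := ℝ) i : EuclideanSpace ℝ (Fin 3) →L[ℝ] ℝ).hasFDerivAt
      (x := p) |>.pow 2
  have key := (((((coord 0).mul (coord 1)).add ((coord 1).mul (coord 2))).add
    ((coord 2).mul (coord 0))).sub (((coord 0).add (coord 1)).add (coord 2))).add_const 1
  refine key.congr_fderiv ?_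
  ext v
  simp
  ring

theorem fderiv_fQ5_eq_zero_iff (p : EuclideanSpace ℝ (Fin 3)) :
    fderiv ℝ fQ5 p = 0 ↔
      p 0 * ((p 1)^2 + (p 2)^2 - 1) = 0 ∧ p 1 * ((p 2)^2 + (p 0)^2 - 1) = 0 ∧
        p 2 * ((p 0)^2 + (p 1)^2 - 1) = 0 := by
  rw [(hasFDerivAt_fQ5 p).fderiv]
  constructor
  · intro h
    have apply_single (i : Fin 3) := DFunLike.congr_fun h (EuclideanSpace.single i (1 : ℝ))
    have h0 := apply_single 0
    have h1 := apply_single 1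
    have h2 := apply_single 2
    simp at h0 h1 h2
    simpa using ⟨h0, h1, h2⟩
  · rintro ⟨h0, h1, h2⟩
    simp only [mul_assoc, h0, h1, h2, mul_zero, zero_smul, add_zero]

/-- the singular points of `Q_{(1,0,-1)}(1)` are the twelve points
`(±1,±1,0), (±1,0,±1), (0,±1,±1)`. -/
theorem stmt_5 :
    {p : EuclideanSpace ℝ (Fin 3) | fQ5 p = 0 ∧ fderiv ℝ fQ5 p = 0} =
      {p : EuclideanSpace ℝ (Fin 3) | ∃ a b : ℝ,
        (a = 1 ∨ a = -1) ∧ (b = 1 ∨ b = -1) ∧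
        ((p 0 = a ∧ p 1 = b ∧ p 2 = 0) ∨
         (p 0 = a ∧ p 1 = 0 ∧ p 2 = b) ∨
         (p 0 = 0 ∧ p 1 = a ∧ p 2 = b))} := by
  ext p
  simp only [Set.mem_ofPred_eq, fderiv_fQ5_eq_zero_iff, fQ5]
  generalize p 0 = x, p 1 = y, p 2 = z
  constructor
  · rintro ⟨hf, hx, hy, hz⟩
    rcases eq_or_ne x 0 with rfl | x0
    · have y0 : y ≠ 0 := by
        rintro rfl
        have : z = 0 := by linarith
        subst this
        norm_num at hf
      have z1 : z ^ 2 = 1 := by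
        have := (mul_eq_zero.mp hy).resolve_left y0
        linarith
      have y1 : y ^ 2 = 1 := by
        have z0 : z ≠ 0 := by rintro rfl; norm_num at z1
        have := (mul_eq_zero.mp hz).resolve_left z0
        linarith
      exact ⟨y, z, sq_eq_one_iff.mp y1, sq_eq_one_iff.mp z1, by simp⟩
    · have hyz := (mul_eq_zero.mp hx).resolve_left x0
      rcases eq_or_ne y 0 with rfl | y0
      · have z1 : z ^ 2 = 1 := by linarith
        have z0 : z ≠ 0 := by rintro rfl; norm_num at z1
        have x1 : x ^ 2 = 1 := by
          have := (mul_eq_zero.mp hz).resolve_left z0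
          linarith
        exact ⟨x, z, sq_eq_one_iff.mp x1, sq_eq_one_iff.mp z1, by simp⟩
      · have hzx := (mul_eq_zero.mp hy).resolve_left y0
        rcases eq_or_ne z 0 with rfl | z0
        · have y1 : y ^ 2 = 1 := by linarith
          have x1 : x ^ 2 = 1 := by linarith
          exact ⟨x, y, sq_eq_one_iff.mp x1, sq_eq_one_iff.mp y1, by simp⟩
        · have hxy := (mul_eq_zero.mp hz).resolve_left z0
          have x2 : x ^ 2 = 1 / 2 := by linarith
          have y2 : y ^ 2 = 1 / 2 := by linarith
          have z2 : z ^ 2 = 1 / 2 := by linarith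
          norm_num [x2, y2, z2] at hf
  · rintro ⟨a, b, rfl | rfl, rfl | rfl, ⟨rfl, rfl, rfl⟩ | ⟨rfl, rfl, rfl⟩ | ⟨rfl, rfl, rfl⟩⟩ <;>
      norm_num
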